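/- arXiv:math/0403067 — 4 statements merged into one kernel-verified Lean document; each statement's English description precedes it below -/
import Mathlib

section
/- Let n, k, p be natural numbers with k ≤ n. Then the determinant Δ(n,p,k) of the (p+1)×(p+1) matrix whose (i,j) entry is the binomial coefficient C(n, k+p−i−j) is nonzero. (This is the paper's Lemma 4: Δ^{n,p+1}_k ≠ 0 whenever C(n,k) ≠ 0.) -/
/-- Binomial coefficient `C(n, m)` for an integer `m`, with the convention
that it is `0` when `m < 0` (and `Nat.choose` already gives `0` when `m > n`). -/
def intChoose (n : ℕ) (m : ℤ) : ℤ :=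
  if 0 ≤ m then (n.choose m.toNat : ℤ) else 0

/-- `Δ(n,p,k)`: the determinant of the `(p+1)×(p+1)` Toeplitz matrix whose
`(i,j)` entry is `C(n, k+p-i-j)`. -/
def binomDet (n p k : ℕ) : ℤ :=
  Matrix.det (fun i j : Fin (p + 1) =>
    intChoose n ((k : ℤ) + p - (i : ℤ) - (j : ℤ)))

open Polynomial in
/-- A nonzero polynomial with at most `n` terms is not divisible by `(X + 1) ^ n`. -/
theorem eq_zero_of_X_add_one_pow_dvd_of_card_support_le (n : ℕ) (P : ℤ[X])
    (hdvd : (X + 1) ^ n ∣ P) (hcard : P.support.card ≤ n) : P = 0 := by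
  induction n generalizing P with
  | zero => simpa using hcard
  | succ n ih =>
    by_contra hP
    obtain ⟨m, hm⟩ := Finset.nonempty_iff_ne_empty.2 (mt support_eq_empty.1 hP)
    set D : ℤ[X] := X * derivative P - C (m : ℤ) * P with hD
    have coeff_D (i : ℕ) : D.coeff i = ((i : ℤ) - m) * P.coeff i := by
      rw [hD, coeff_sub, coeff_C_mul]
      cases i with
      | zero => simp
      | succ i => rw [coeff_X_mul, coeff_derivative]; push_cast; ring
    have D_eq_zero : D = 0 := by
      refine ih D ?_ ?_
      · obtain ⟨R, rfl⟩ := hdvd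
        refine ⟨X * ((n + 1 : ℤ[X]) * R + (X + 1) * derivative R) - C (m : ℤ) * ((X + 1) * R), ?_⟩
        simp only [hD, derivative_mul, derivative_pow_succ, derivative_X,
          derivative_one, map_add, map_natCast, map_one]
        ring
      · have hsub : D.support ⊆ P.support.erase m := by
          intro i hi
          rw [mem_support_iff, coeff_D] at hi
          refine Finset.mem_erase.2 ⟨?_, mem_support_iff.2 (right_ne_zero_of_mul hi)⟩
          rintro rfl
          simp at hi
        have := Finset.card_le_card hsub
        rw [Finset.card_erase_of_mem hm] at this
        omega
    have P_eq : P = monomial m (P.coeff m) := by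
      ext i
      rw [coeff_monomial]
      split_ifs with h
      · rw [h]
      · have hi := coeff_D i
        rw [D_eq_zero, coeff_zero] at hi
        exact (mul_eq_zero.1 hi.symm).resolve_left (by omega)
    have hroot : P.eval (-1) = 0 := by
      obtain ⟨R, rfl⟩ := hdvd
      simp
    rw [P_eq, eval_monomial] at hroot
    exact mem_support_iff.1 hm ((mul_eq_zero.1 hroot).resolve_right (by simp))

open Polynomial in
theorem coeff_X_pow_mul_X_add_one_pow (n j m : ℕ) :
    (X ^ j * (X + 1) ^ n : ℤ[X]).coeff m = intChoose n ((m : ℤ) - j) := by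
  rw [coeff_X_pow_mul', coeff_X_add_one_pow, intChoose]
  by_cases h : j ≤ m
  · rw [if_pos h, if_pos (by omega), show ((m : ℤ) - j).toNat = m - j by omega]
  · rw [if_neg h, if_neg (by omega)]

/-- Lemma 4 of the paper: if `k ≤ n` (i.e. `C(n,k) ≠ 0`), then
`Δ^{n,p+1}_k ≠ 0`. -/
theorem binomDet_ne_zero (n k p : ℕ) (hkn : k ≤ n) :
    binomDet n p k ≠ 0 := by
  intro hdet
  obtain ⟨v, hv, hmul⟩ := Matrix.exists_mulVec_eq_zero_iff.2 hdet
  let Q : Polynomial ℤ := ∑ j : Fin (p + 1), Polynomial.C (v j) * Polynomial.X ^ (j : ℕ)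
  have coeff_mul (m : ℕ) : (Q * (Polynomial.X + 1) ^ n).coeff m =
      ∑ j : Fin (p + 1), v j * intChoose n ((m : ℤ) - (j : ℕ)) := by
    simp only [Q, Finset.sum_mul, Polynomial.finsetSum_coeff, mul_assoc, Polynomial.coeff_C_mul,
      coeff_X_pow_mul_X_add_one_pow]
  have hsub : (Q * (Polynomial.X + 1) ^ n).support ⊆
      Finset.range k ∪ Finset.Ico (k + p + 1) (n + p + 1) := by
    intro m hm
    rw [Polynomial.mem_support_iff, coeff_mul] at hm
    by_contra hmem
    simp only [Finset.mem_union, Finset.mem_range, Finset.mem_Ico] at hmem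
    apply hm
    by_cases hmk : m ≤ k + p
    · refine Eq.trans ?_ (congrFun hmul ⟨k + p - m, by omega⟩)
      refine Finset.sum_congr rfl fun j _ => ?_
      rw [mul_comm]
      congr 2
      push_cast [Nat.cast_sub hmk]
      ring
    · refine Finset.sum_eq_zero fun j _ => ?_
      rw [intChoose, if_pos (by omega), Nat.choose_eq_zero_of_lt (by omega), Nat.cast_zero,
        mul_zero]
  have hcard : (Q * (Polynomial.X + 1) ^ n).support.card ≤ n := by
    refine (Finset.card_le_card hsub).trans ((Finset.card_union_le _ _).trans ?_)
    rw [Finset.card_range, Nat.card_Ico]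
    omega
  have hQ : Q = 0 := (mul_eq_zero.1 (eq_zero_of_X_add_one_pow_dvd_of_card_support_le n _
    (dvd_mul_left _ _) hcard)).resolve_right (pow_ne_zero _ (Polynomial.X_add_C_ne_zero 1))
  refine hv (funext fun i => ?_)
  have hi := congrArg (fun R => R.coeff (i : ℕ)) hQ
  simpa [Q, Polynomial.finsetSum_coeff, Polynomial.coeff_X_pow, Fin.val_inj] using hi
end

section
/- For all natural numbers n, k, p, the determinant of the (p+1)×(p+1) matrix whose (i,j) entry is C(n, k+p−i−j) equals the determinant of the (p+1)×(p+1) matrix whose (i,j) entry is C(n+p−j, k+p−i−j) (columns indexed by j = 0,…,p from left to right). This is the column-operation identity obtained by repeatedly adding each column to the one on its right, using Pascal's rule C(n,m) + C(n,m−1) = C(n+1,m). -/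
theorem intChoose_succ (n : ℕ) (m : ℤ) :
    intChoose (n + 1) m = intChoose n m + intChoose n (m - 1) := by
  rcases lt_trichotomy m 0 with h | rfl | h
  · simp [intChoose, not_le.2 h, show ¬ 1 ≤ m by lia]
  · simp [intChoose]
  · obtain ⟨t, rfl⟩ : ∃ t : ℕ, m = t + 1 := ⟨(m - 1).toNat, by lia⟩
    have ht : (0 : ℤ) ≤ (t : ℤ) + 1 := by lia
    have hs : ((t : ℤ) + 1).toNat = t + 1 := by lia
    simp [intChoose, ht, hs, Nat.choose_succ_succ, add_comm]

/-- Vandermonde's identity for `intChoose`. -/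
theorem intChoose_add (n a : ℕ) (m : ℤ) :
    intChoose (n + a) m = ∑ s ∈ Finset.range (a + 1), (a.choose s : ℤ) * intChoose n (m - s) := by
  induction a generalizing n with
  | zero => simp
  | succ a ih =>
    rw [Finset.sum_choose_succ_mul (fun s _ => intChoose n (m - s)) a, ← Finset.sum_add_distrib,
      show n + (a + 1) = n + 1 + a by ring, ih]
    refine Finset.sum_congr rfl fun s _ => ?_
    rw [intChoose_succ, sub_sub m]
    push_cast
    ring

/-- The column-operation identity: the determinant of the matrix with entries
`C(n, k+p-i-j)` equals the determinant of the matrix with entries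
`C(n+p-j, k+p-i-j)`, obtained by repeatedly adding each column to the one on
its right via Pascal's rule. -/
theorem binomDet_column_ops (n k p : ℕ) :
    Matrix.det (fun i j : Fin (p + 1) =>
      intChoose n ((k : ℤ) + p - (i : ℤ) - (j : ℤ))) =
    Matrix.det (fun i j : Fin (p + 1) =>
      intChoose (n + (p - (j : ℕ))) ((k : ℤ) + p - (i : ℤ) - (j : ℤ))) := by
  let A : Matrix (Fin (p + 1)) (Fin (p + 1)) ℤ := fun i j =>
    intChoose n ((k : ℤ) + p - (i : ℤ) - (j : ℤ))
  let U : Matrix (Fin (p + 1)) (Fin (p + 1)) ℤ := fun l j =>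
    if (j : ℕ) ≤ l then ((p - (j : ℕ)).choose (l - j) : ℤ) else 0
  have hU : U.det = 1 := by
    rw [Matrix.det_of_isLowerTriangular U fun i j hij => if_neg (not_le.2 hij)]
    simp [U]
  have hAU : A * U = fun i j : Fin (p + 1) =>
      intChoose (n + (p - (j : ℕ))) ((k : ℤ) + p - (i : ℤ) - (j : ℤ)) := by
    ext i j
    have hj : (j : ℕ) ≤ p := Nat.lt_succ_iff.1 j.2
    rw [Matrix.mul_apply, intChoose_add]
    simp only [A, U]
    rw [Fin.sum_univ_eq_sum_range (fun l : ℕ => intChoose n ((k : ℤ) + p - (i : ℤ) - (l : ℤ)) *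
      if (j : ℕ) ≤ l then ((p - (j : ℕ)).choose (l - j) : ℤ) else 0) (p + 1),
      ← Finset.sum_range_add_sum_Ico _ (show (j : ℕ) ≤ p + 1 by lia),
      Finset.sum_eq_zero fun l hl => by simp [Finset.mem_range.1 hl], zero_add,
      Finset.sum_Ico_eq_sum_range, Nat.sub_add_comm hj]
    refine Finset.sum_congr rfl fun s _ => ?_
    rw [if_pos (Nat.le_add_right _ _), Nat.add_sub_cancel_left, mul_comm, sub_sub _ (j : ℤ)]
    push_cast
    rfl
  rw [← hAU, Matrix.det_mul, hU, mul_one]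
end

section
/- Let n, k, p be natural numbers with k ≤ n, and let Δ(n,p,k) be the determinant of the (p+1)×(p+1) matrix with (i,j) entry C(n, k+p−i−j). Then the recursion n! · (n+p−k+1)! · Δ(n+1,p,k) = (n+p+1)! · (n−k)! · Δ(n,p,k) holds (as an identity of integers); equivalently, Δ(n+1,p,k) = [(n+p+1)! (n−k)! / (n! (n+p−k+1)!)] · Δ(n,p,k). -/
/-- Vandermonde's convolution for `intChoose`, truncated at any bound `p` on `j`. -/
theorem sum_intChoose_mul_choose (n r : ℕ) {j p : ℕ} (hj : j ≤ p) :
    ∑ l ∈ Finset.range (p + 1), intChoose n ((r : ℤ) - l) * (j.choose l : ℤ) =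
      ((n + j).choose r : ℤ) := by
  have hp : ∑ l ∈ Finset.range (p + 1), intChoose n ((r : ℤ) - l) * (j.choose l : ℤ) =
      ∑ l ∈ Finset.range (r + p + 1), intChoose n ((r : ℤ) - l) * (j.choose l : ℤ) := by
    refine Finset.sum_subset (fun l hl => ?_) (fun l _ hl => ?_)
    · simp only [Finset.mem_range] at hl ⊢
      omega
    · rw [Nat.choose_eq_zero_of_lt (by simp only [Finset.mem_range] at hl; omega)]
      simp
  have hr : ∑ l ∈ Finset.range (r + 1), intChoose n ((r : ℤ) - l) * (j.choose l : ℤ) =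
      ∑ l ∈ Finset.range (r + p + 1), intChoose n ((r : ℤ) - l) * (j.choose l : ℤ) := by
    refine Finset.sum_subset (fun l hl => ?_) (fun l _ hl => ?_)
    · simp only [Finset.mem_range] at hl ⊢
      omega
    · rw [intChoose, if_neg (by simp only [Finset.mem_range] at hl; omega), zero_mul]
  rw [hp, ← hr, add_comm n j, Nat.add_choose_eq, Finset.Nat.sum_antidiagonal_eq_sum_range_succ_mk]
  push_cast
  refine Finset.sum_congr rfl fun l hl => ?_
  have hl : l ≤ r := by simpa [Nat.lt_succ_iff] using hl
  rw [intChoose, if_pos (by omega), show ((r : ℤ) - l).toNat = r - l by omega, mul_comm]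

/-- Column operations turn `Δ(n,p,k)` into a determinant of ordinary binomial coefficients. -/
theorem binomDet_eq_det_choose (n p k : ℕ) :
    binomDet n p k =
      Matrix.det (Matrix.of fun i j : Fin (p + 1) =>
        ((n + (j : ℕ)).choose (k + (p - (i : ℕ))) : ℤ)) := by
  let B : Matrix (Fin (p + 1)) (Fin (p + 1)) ℤ :=
    Matrix.of fun i j => intChoose n ((k : ℤ) + p - (i : ℤ) - (j : ℤ))
  let U : Matrix (Fin (p + 1)) (Fin (p + 1)) ℤ := Matrix.of fun l j => ((j : ℕ).choose l : ℤ)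
  have hU : U.det = 1 := by
    rw [Matrix.det_of_isUpperTriangular]
    · simp [U]
    · intro i j hij
      have hij : (j : ℕ) < i := hij
      simp [U, Nat.choose_eq_zero_of_lt hij]
  change B.det = _
  rw [← mul_one B.det, ← hU, ← Matrix.det_mul]
  congr 1
  ext i j
  rw [Matrix.mul_apply, Matrix.of_apply, ← sum_intChoose_mul_choose n _ (Nat.lt_succ_iff.mp j.2),
    Finset.sum_range]
  refine Finset.sum_congr rfl fun l _ => ?_
  have hi : (i : ℕ) ≤ p := Nat.lt_succ_iff.mp i.2
  simp only [B, U, Matrix.of_apply]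
  congr 2
  push_cast [hi]
  ring

theorem choose_mul_factorial_mul_factorial_eq_mul_descFactorial (k q s : ℕ) :
    (k + q).choose (k + s) * (k + s).factorial * q.factorial =
      (k + q).factorial * q.descFactorial s := by
  rcases le_or_gt s q with h | h
  · rw [← Nat.choose_mul_factorial_mul_factorial (Nat.add_le_add_left h k),
      ← Nat.factorial_mul_descFactorial h, Nat.add_sub_add_left]
    ring
  · rw [Nat.choose_eq_zero_of_lt (by omega), Nat.descFactorial_eq_zero_iff_lt.mpr h]
    simp

theorem det_descFactorial_rev (m p : ℕ) :
    Matrix.det (Matrix.of fun i j : Fin (p + 1) =>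
        ((m + (j : ℕ)).descFactorial (p - (i : ℕ)) : ℤ)) =
      Equiv.Perm.sign (Fin.revPerm : Equiv.Perm (Fin (p + 1))) *
        (Matrix.vandermonde fun j : Fin (p + 1) => ((j : ℕ) : ℤ)).det := by
  rw [← Int.cast_id (n := ((Equiv.Perm.sign (Fin.revPerm : Equiv.Perm (Fin (p + 1))) : ℤˣ) : ℤ)),
    ← Matrix.det_vandermonde_add _ (m : ℤ),
    Matrix.det_eval_matrixOfPolynomials_eq_det_vandermonde _
      (fun i => descPochhammer ℤ i) (fun i => descPochhammer_natDegree ℤ i)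
      (fun i => monic_descPochhammer ℤ i), ← Matrix.det_permute', ← Matrix.det_transpose]
  congr 1
  ext i j
  simp [← descPochhammer_eval_eq_descFactorial, Fin.val_rev, add_comm]

/-- `Δ(k+m,p,k)` in terms of a Vandermonde determinant that does not depend on `m`. -/
theorem prod_factorial_mul_binomDet (k m p : ℕ) :
    (∏ i : Fin (p + 1), ((k + (p - (i : ℕ))).factorial : ℤ)) *
        (∏ j ∈ Finset.range (p + 1), ((m + j).factorial : ℤ)) * binomDet (k + m) p k =
      (∏ j ∈ Finset.range (p + 1), ((k + m + j).factorial : ℤ)) *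
        (Equiv.Perm.sign (Fin.revPerm : Equiv.Perm (Fin (p + 1))) *
          (Matrix.vandermonde fun j : Fin (p + 1) => ((j : ℕ) : ℤ)).det) := by
  rw [← det_descFactorial_rev m p, binomDet_eq_det_choose, Finset.prod_range, Finset.prod_range,
    mul_assoc, ← Matrix.det_mul_row, ← Matrix.det_mul_column, ← Matrix.det_mul_row]
  congr 1
  ext i j
  have h := choose_mul_factorial_mul_factorial_eq_mul_descFactorial k (m + j) (p - i)
  rw [← add_assoc] at h
  simp only [Matrix.of_apply]
  rw [← Nat.cast_mul ((k + m + (j : ℕ)).factorial), ← h]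
  push_cast
  ring

theorem prod_range_factorial_succ_mul (a p : ℕ) :
    (∏ j ∈ Finset.range (p + 1), ((a + 1 + j).factorial : ℤ)) * a.factorial =
      (∏ j ∈ Finset.range (p + 1), ((a + j).factorial : ℤ)) * (a + p + 1).factorial := by
  have h := Finset.prod_range_succ' (fun j => ((a + j).factorial : ℤ)) (p + 1)
  rw [Finset.prod_range_succ] at h
  simpa [add_assoc, add_comm, add_left_comm] using h.symm

/-- The recursion of the paper's Lemma 4:
`n! (n+p-k+1)! Δ(n+1,p,k) = (n+p+1)! (n-k)! Δ(n,p,k)`. -/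
theorem binomDet_recursion (n k p : ℕ) (hkn : k ≤ n) :
    (n.factorial : ℤ) * ((n + p - k + 1).factorial : ℤ) * binomDet (n + 1) p k =
    ((n + p + 1).factorial : ℤ) * ((n - k).factorial : ℤ) * binomDet n p k := by
  obtain ⟨m, rfl⟩ := Nat.exists_eq_add_of_le hkn
  rw [show k + m + p - k + 1 = m + p + 1 by omega, Nat.add_sub_cancel_left]
  have h₀ := prod_factorial_mul_binomDet k m p
  have h₁ := prod_factorial_mul_binomDet k (m + 1) p
  have hm := prod_range_factorial_succ_mul m p
  have hn := prod_range_factorial_succ_mul (k + m) p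
  rw [← add_assoc k m 1] at h₁
  have hK : (∏ i : Fin (p + 1), ((k + (p - (i : ℕ))).factorial : ℤ)) ≠ 0 :=
    Finset.prod_ne_zero_iff.mpr fun i _ => by positivity
  have hP : (∏ j ∈ Finset.range (p + 1), ((m + j).factorial : ℤ)) ≠ 0 :=
    Finset.prod_ne_zero_iff.mpr fun i _ => by positivity
  refine mul_left_cancel₀ (mul_ne_zero hK hP) ?_
  generalize (∏ i : Fin (p + 1), ((k + (p - (i : ℕ))).factorial : ℤ)) = K at *
  generalize (Equiv.Perm.sign (Fin.revPerm : Equiv.Perm (Fin (p + 1))) *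
    (Matrix.vandermonde fun j : Fin (p + 1) => ((j : ℕ) : ℤ)).det : ℤ) = V at *
  linear_combination (-((k + m).factorial : ℤ) * K * binomDet (k + m + 1) p k) * hm +
    ((k + m).factorial * m.factorial : ℤ) * h₁ + (m.factorial * V : ℤ) * hn -
    (m.factorial * (k + m + p + 1).factorial : ℤ) * h₀
end

section
/- Let n, k, p be natural numbers with k ≤ n, and let Δ(n,p,k) be the determinant of the (p+1)×(p+1) matrix with (i,j) entry C(n, k+p−i−j). Then, as an identity of rational numbers, Δ(n,p,k) = (−1)^{p(p+1)/2} · ∏_{m=k}^{n−1} [(m+p+1)! (m−k)!] / [m! (m+p−k+1)!]. In particular Δ(n,p,k) has sign (−1)^{p(p+1)/2}. -/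
section BinomDet

open Finset Matrix

theorem sign_revPerm_fin (p : ℕ) :
    Equiv.Perm.sign (Fin.revPerm : Equiv.Perm (Fin (p + 1))) = (-1) ^ (p * (p + 1) / 2) := by
  rw [Equiv.Perm.sign_eq_prod_prod_Iio]
  have h (j : Fin (p + 1)) :
      ∏ i ∈ Iio j, (if Fin.revPerm i < Fin.revPerm j then (1 : ℤˣ) else -1) = (-1) ^ (j : ℕ) := by
    rw [prod_congr rfl fun i hi => if_neg ?_, prod_const, Fin.card_Iio]
    simpa using (mem_Iio.mp hi).le
  rw [prod_congr rfl fun j _ => h j, prod_pow_eq_pow_sum, Fin.sum_univ_eq_sum_range (fun j => j),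
    sum_range_id, Nat.add_sub_cancel, mul_comm]

theorem intChoose_succ_succ (n : ℕ) (m : ℤ) :
    intChoose (n + 1) (m + 1) = intChoose n m + intChoose n (m + 1) := by
  rcases lt_trichotomy m (-1) with h | rfl | h
  · simp [intChoose, show ¬ 0 ≤ m + 1 by lia, show ¬ 0 ≤ m by lia]
  · simp [intChoose]
  · lift m to ℕ using by lia
    simp [intChoose, show (0 : ℤ) ≤ (m : ℤ) + 1 by lia, show ((m : ℤ) + 1).toNat = m + 1 by lia,
      Nat.choose_succ_succ]

/-- Vandermonde's convolution for binomial coefficients with an integer lower index. -/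
theorem intChoose_add_s4 (n j : ℕ) (a : ℤ) :
    intChoose (n + j) (a + j) = ∑ l ∈ range (j + 1), (j.choose l : ℤ) * intChoose n (a + l) := by
  induction j generalizing n a with
  | zero => simp
  | succ j ih =>
    rw [sum_choose_succ_mul (fun l _ => intChoose n (a + l)), ← sum_add_distrib,
      show n + (j + 1) = n + 1 + j by ring,
      show a + ((j + 1 : ℕ) : ℤ) = a + 1 + j by push_cast; ring, ih]
    refine sum_congr rfl fun l _ => ?_
    rw [show a + 1 + (l : ℤ) = a + l + 1 by ring, intChoose_succ_succ]
    push_cast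
    rw [← add_assoc a]
    ring

theorem binomDet_eq_sign_mul_det (n p k : ℕ) :
    binomDet n p k = (-1) ^ (p * (p + 1) / 2) *
      det (of fun i j : Fin (p + 1) => intChoose n ((k : ℤ) - (i : ℕ) + (j : ℕ))) := by
  have h := det_permute' Fin.revPerm
    (of fun i j : Fin (p + 1) => intChoose n ((k : ℤ) - (i : ℕ) + (j : ℕ)))
  rw [sign_revPerm_fin] at h
  push_cast at h
  rw [← h, binomDet]
  congr 1
  ext i j
  simp only [submatrix_apply, of_apply, Fin.revPerm_apply, Fin.val_rev, id]
  congr 1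
  have := j.is_lt
  lia

theorem det_intChoose_toeplitz (n p k : ℕ) :
    det (of fun i j : Fin (p + 1) => intChoose n ((k : ℤ) - (i : ℕ) + (j : ℕ))) =
      det (of fun i j : Fin (p + 1) => intChoose (n + j) ((k : ℤ) - (i : ℕ) + (j : ℕ))) := by
  have hU : det (of fun l j : Fin (p + 1) => ((j : ℕ).choose l : ℤ)) = 1 := by
    rw [det_of_isUpperTriangular]
    · simp
    · intro i j hij
      simpa using Nat.choose_eq_zero_of_lt hij
  rw [← mul_one (det _), ← hU, ← det_mul]
  congr 1
  ext i j
  rw [mul_apply, of_apply, intChoose_add_s4]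
  simp only [of_apply]
  rw [Fin.sum_univ_eq_sum_range
    (fun l => intChoose n ((k : ℤ) - (i : ℕ) + l) * ((j : ℕ).choose l : ℤ)) (p + 1)]
  simp only [mul_comm]
  symm
  refine sum_subset (by simpa using j.2) fun l _ hl => ?_
  rw [Nat.choose_eq_zero_of_lt (by simpa using hl)]
  simp

theorem intChoose_eq_descFactorial {n k : ℕ} (hkn : k ≤ n) (i j : ℕ) :
    (intChoose (n + j) ((k : ℤ) - i + j) : ℚ) =
      (n + j).factorial / (k + j).factorial *
        (1 / (n - k + i).factorial * (k + j).descFactorial i) := by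
  by_cases h : i ≤ k + j
  · rw [intChoose, if_pos (by lia), show ((k : ℤ) - i + j).toNat = k + j - i by lia]
    have h₁ := Nat.choose_mul_factorial_mul_factorial (show k + j - i ≤ n + j by lia)
    rw [show n + j - (k + j - i) = n - k + i by lia] at h₁
    rw [← h₁, ← Nat.factorial_mul_descFactorial h]
    have := (Nat.descFactorial_pos.mpr h).ne'
    have := Nat.factorial_ne_zero (k + j - i)
    have := Nat.factorial_ne_zero (n - k + i)
    push_cast
    field_simp
  · rw [intChoose, if_neg (by lia), Nat.descFactorial_of_lt (by lia)]
    simp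

theorem det_descFactorial (p k : ℕ) :
    det (of fun i j : Fin (p + 1) => ((k + j : ℕ).descFactorial i : ℚ)) = p.superFactorial := by
  rw [← det_vandermonde_id_eq_superFactorial, ← det_vandermonde_add _ (k : ℚ),
    det_eval_matrixOfPolynomials_eq_det_vandermonde _ (fun i => descPochhammer ℚ i)
      (fun i => descPochhammer_natDegree ℚ i) (fun i => monic_descPochhammer ℚ i),
    ← det_transpose]
  congr 1
  ext i j
  simp only [transpose_apply, of_apply]
  rw [← descPochhammer_eval_eq_descFactorial]
  push_cast
  rw [add_comm]

theorem det_intChoose_eq_prod {n k : ℕ} (hkn : k ≤ n) (p : ℕ) :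
    ((det (of fun i j : Fin (p + 1) => intChoose (n + j) ((k : ℤ) - (i : ℕ) + (j : ℕ))) : ℤ) : ℚ) =
      p.superFactorial * ∏ j ∈ range (p + 1),
        ((n + j).factorial : ℚ) / ((k + j).factorial * (n - k + j).factorial) := by
  rw [Int.cast_det]
  have : (of fun i j : Fin (p + 1) => intChoose (n + j) ((k : ℤ) - (i : ℕ) + (j : ℕ))).map
      (fun x : ℤ => (x : ℚ)) = of fun i j : Fin (p + 1) =>
        ((n + j).factorial / (k + j).factorial : ℚ) * (of fun i j : Fin (p + 1) =>
          (1 / (n - k + i).factorial : ℚ) * (of fun i j : Fin (p + 1) =>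
            ((k + j : ℕ).descFactorial i : ℚ)) i j) i j := by
    ext i j
    simp only [map_apply, of_apply]
    exact intChoose_eq_descFactorial hkn i j
  rw [this, det_mul_row, det_mul_column, det_descFactorial,
    Fin.prod_univ_eq_prod_range (fun j => ((n + j).factorial / (k + j).factorial : ℚ)),
    Fin.prod_univ_eq_prod_range (fun i => (1 / (n - k + i).factorial : ℚ)),
    ← mul_assoc, ← prod_mul_distrib, mul_comm]
  congr 1
  refine prod_congr rfl fun j _ => ?_
  field_simp

theorem factorial_mul_prod_range (n p : ℕ) :
    (n.factorial : ℚ) * ∏ j ∈ range (p + 1), ((n + j + 1 : ℕ) : ℚ) = (n + p + 1).factorial := by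
  induction p with
  | zero => simp [Nat.factorial_succ, mul_comm]
  | succ p ih =>
    rw [prod_range_succ, ← mul_assoc, ih, ← add_assoc n, Nat.factorial_succ (n + p + 1)]
    push_cast
    ring

theorem superFactorial_eq_prod_range_factorial (p : ℕ) :
    p.superFactorial = ∏ j ∈ range (p + 1), j.factorial := by
  induction p with
  | zero => simp
  | succ p ih => rw [Nat.superFactorial_succ, prod_range_succ, ih, mul_comm]

theorem superFactorial_mul_prod_eq {n k : ℕ} (hkn : k ≤ n) (p : ℕ) :
    (p.superFactorial : ℚ) * ∏ j ∈ range (p + 1),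
        ((n + j).factorial : ℚ) / ((k + j).factorial * (n - k + j).factorial) =
      ∏ m ∈ Ico k n, (((m + p + 1).factorial : ℚ) * ((m - k).factorial : ℚ)) /
        (((m.factorial : ℚ)) * (((m + p - k + 1).factorial : ℚ))) := by
  induction n, hkn using Nat.le_induction with
  | base =>
    rw [superFactorial_eq_prod_range_factorial]
    push_cast
    rw [← prod_mul_distrib, Ico_self, prod_empty]
    refine prod_eq_one fun j _ => ?_
    rw [Nat.sub_self, zero_add]
    field_simp
  | succ n hkn ih =>
    rw [prod_Ico_succ_top hkn, ← ih, mul_assoc]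
    congr 1
    rw [show n + p - k + 1 = n - k + p + 1 by lia, ← factorial_mul_prod_range n,
      ← factorial_mul_prod_range (n - k)]
    have hstep (j : ℕ) :
        ((n + 1 + j).factorial : ℚ) / ((k + j).factorial * (n + 1 - k + j).factorial) =
          (n + j).factorial / ((k + j).factorial * (n - k + j).factorial) *
            (((n + j + 1 : ℕ) : ℚ) / ((n - k + j + 1 : ℕ) : ℚ)) := by
      rw [show n + 1 + j = n + j + 1 by ring, show n + 1 - k + j = n - k + j + 1 by lia,
        Nat.factorial_succ, Nat.factorial_succ]
      push_cast
      field_simp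
    rw [prod_congr rfl fun j _ => hstep j, prod_mul_distrib, prod_div_distrib (f := fun j => ((n + j + 1 : ℕ) : ℚ))]
    congr 1
    have : ∏ j ∈ range (p + 1), ((n - k + j + 1 : ℕ) : ℚ) ≠ 0 :=
      prod_ne_zero_iff.mpr fun j _ => by positivity
    field_simp

end BinomDet

/-- Closed formula for the paper's Lemma 4:
`Δ(n,p,k) = (-1)^(p(p+1)/2) ∏_{m=k}^{n-1} [(m+p+1)!(m-k)!] / [m!(m+p-k+1)!]`
as rational numbers; in particular `Δ(n,p,k)` has sign `(-1)^(p(p+1)/2)`. -/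
theorem binomDet_closed_formula (n k p : ℕ) (hkn : k ≤ n) :
    ((binomDet n p k : ℚ) =
      (-1 : ℚ) ^ (p * (p + 1) / 2) *
        ∏ m ∈ Finset.Ico k n,
          (((m + p + 1).factorial : ℚ) * ((m - k).factorial : ℚ)) /
            (((m.factorial : ℚ)) * (((m + p - k + 1).factorial : ℚ)))) ∧
    0 < (-1 : ℚ) ^ (p * (p + 1) / 2) * (binomDet n p k : ℚ) := by
  have h : (binomDet n p k : ℚ) =
      (-1 : ℚ) ^ (p * (p + 1) / 2) *
        ∏ m ∈ Finset.Ico k n,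
          (((m + p + 1).factorial : ℚ) * ((m - k).factorial : ℚ)) /
            (((m.factorial : ℚ)) * (((m + p - k + 1).factorial : ℚ))) := by
    rw [← superFactorial_mul_prod_eq hkn, ← det_intChoose_eq_prod hkn,
      ← det_intChoose_toeplitz, binomDet_eq_sign_mul_det]
    push_cast
    rfl
  refine ⟨h, ?_⟩
  rw [h, ← mul_assoc, ← mul_pow, neg_one_mul, neg_neg, one_pow, one_mul]
  exact Finset.prod_pos fun m _ => by positivity
end
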